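/- Let X be a compact metrizable topological space and let Δ be a weak-*-closed set of Borel probability measures on X. (a) If (X, Δ) has the small boundary property, then for every continuous f : X → ℝ and every ε > 0 there exist uniformly bounded sequences (g_n) and (h_n) of continuous real-valued functions on X which are Cauchy with respect to the seminorm ‖·‖_{2,Δ}, such that ‖f − g_n‖_∞ < ε for all n and lim_{n→∞} sup_{μ∈Δ} ∫_X |g_n h_n − 1|² dμ = 0. (b) Conversely, if for every continuous f : X → ℝ and every ε > 0 there exist uniformly bounded ‖·‖_{2,Δ}-Cauchy sequences (g_n) and (h_n) of continuous real-valued functions on X such that limsup_{n→∞} sup_{μ∈Δ} (∫_X |f − g_n|² dμ)^{1/2} < ε and lim_{n→∞} sup_{μ∈Δ} ∫_X |g_n h_n − 1|² dμ = 0, then (X, Δ) has the small boundary property. -/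

import Mathlib

open MeasureTheory Filter Topology
open scoped NNReal ENNReal

/-- The pair `(X, Δ)` has the small boundary property. -/
def SmallBoundaryProperty {X : Type*} [TopologicalSpace X] [MeasurableSpace X]
    (Δ : Set (ProbabilityMeasure X)) : Prop :=
  ∀ (x : X) (U : Set X), IsOpen U → x ∈ U →
    ∃ V : Set X, IsClosed V ∧ x ∈ interior V ∧ V ⊆ U ∧
      ∀ μ ∈ Δ, μ (frontier V) = 0

/-- The uniform 2-seminorm `‖h‖_{2,Δ} = sup_{μ ∈ Δ} (∫ |h|² dμ)^{1/2}`. -/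
noncomputable def uniformTraceNorm {X : Type*} [TopologicalSpace X] [MeasurableSpace X]
    (Δ : Set (ProbabilityMeasure X)) (h : C(X, ℝ)) : ℝ :=
  ⨆ μ ∈ Δ, Real.sqrt (∫ x, (h x) ^ 2 ∂(μ : Measure X))

/-- A sequence of continuous functions is Cauchy with respect to `‖·‖_{2,Δ}`. -/
def IsTraceNormCauchy {X : Type*} [TopologicalSpace X] [MeasurableSpace X]
    (Δ : Set (ProbabilityMeasure X)) (g : ℕ → C(X, ℝ)) : Prop :=
  ∀ η : ℝ, 0 < η → ∃ N : ℕ, ∀ n ≥ N, ∀ m ≥ N, uniformTraceNorm Δ (g n - g m) < η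

section BoundedSuprema

variable {α : Type*} {s : Set α} {F : α → ℝ} {B : ℝ}

lemma biSup_le_of_forall_mem_le (hB : 0 ≤ B) (h : ∀ a ∈ s, F a ≤ B) : ⨆ a ∈ s, F a ≤ B :=
  Real.iSup_le (fun a => Real.iSup_le (h a) hB) hB

lemma biSup_nonneg_of_nonneg (h : ∀ a, 0 ≤ F a) : 0 ≤ ⨆ a ∈ s, F a :=
  Real.iSup_nonneg fun a => Real.iSup_nonneg fun _ => h a

lemma le_biSup_of_forall_mem_le (hB : 0 ≤ B) (h : ∀ a ∈ s, F a ≤ B) {a : α} (ha : a ∈ s) :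
    F a ≤ ⨆ a ∈ s, F a := by
  have hbdd : BddAbove (Set.range fun a => ⨆ _ : a ∈ s, F a) :=
    ⟨B, by rintro _ ⟨b, rfl⟩; exact Real.iSup_le (h b) hB⟩
  simpa [ciSup_pos ha] using le_ciSup hbdd a

end BoundedSuprema

section ContinuousFunctions

variable {X : Type*} [TopologicalSpace X]

/-- Multiplying by a function that vanishes on the discontinuity set of a bounded function
restores continuity. -/
lemma continuous_mul_of_continuousAt_of_eq_zero {K : Set X} {u s : X → ℝ} {B : ℝ}
    (hu : Continuous u) (hK : ∀ x ∈ K, u x = 0) (hB : ∀ x, |s x| ≤ B)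
    (hs : ∀ x ∉ K, ContinuousAt s x) : Continuous fun x => u x * s x := by
  refine continuous_iff_continuousAt.2 fun x => ?_
  by_cases hx : x ∈ K
  · have hux : Tendsto u (𝓝 x) (𝓝 0) := hK x hx ▸ hu.tendsto x
    have hbdd : IsBoundedUnder (· ≤ ·) (𝓝 x) ((‖·‖) ∘ s) :=
      isBoundedUnder_of ⟨B, hB⟩
    simpa [ContinuousAt, hK x hx] using hux.zero_mul_isBoundedUnder_le hbdd
  · exact hu.continuousAt.mul (hs x hx)

variable [CompactSpace X] [MeasurableSpace X] {Δ : Set (ProbabilityMeasure X)}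

/-- The functions whose small values have `Δ`-uniformly small measure. -/
def smallNearZero (Δ : Set (ProbabilityMeasure X)) (η : ℝ) : Set C(X, ℝ) :=
  {F | ∃ δ > 0, ∀ μ ∈ Δ, (μ : Measure X).real {x | |F x| ≤ δ} ≤ η}

lemma isOpen_smallNearZero (Δ : Set (ProbabilityMeasure X)) (η : ℝ) :
    IsOpen (smallNearZero Δ η) := by
  refine Metric.isOpen_iff.2 fun F ⟨δ, hδ, hF⟩ => ⟨δ / 2, half_pos hδ, fun G hG => ?_⟩
  refine ⟨δ / 2, half_pos hδ, fun μ hμ => (measureReal_mono fun x hx => ?_).trans (hF μ hμ)⟩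
  have h1 := (ContinuousMap.dist_apply_le_dist x).trans_lt (Metric.mem_ball.1 hG)
  rw [Real.dist_eq, abs_lt] at h1
  have h2 : |G x| ≤ δ / 2 := hx
  rw [abs_le] at h2
  change |F x| ≤ δ
  exact abs_le.2 ⟨by linarith, by linarith⟩

/-- Under the small boundary property, a continuous function is uniformly close to a function
bounded away from zero whose discontinuities lie in a closed uniformly null set. -/
lemma SmallBoundaryProperty.exists_approx_away_from_zero (hS : SmallBoundaryProperty Δ)
    (f : C(X, ℝ)) {ε : ℝ} (hε : 0 < ε) :
    ∃ (K : Set X) (s : X → ℝ), IsClosed K ∧ (∀ μ ∈ Δ, (μ : Measure X) K = 0) ∧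
      (∀ x ∉ K, ContinuousAt s x) ∧ ∀ x, |f x - s x| ≤ 3 * ε / 4 ∧ ε / 4 ≤ |s x| := by
  suffices h : ∃ C : Set X, Set.univ ⊆ C ∧ (∀ μ ∈ Δ, (μ : Measure X) (frontier C) = 0) ∧
      ∃ (K : Set X) (s : X → ℝ), IsClosed K ∧ (∀ μ ∈ Δ, (μ : Measure X) K = 0) ∧
      (∀ x ∉ K, ContinuousAt s x) ∧ ∀ x ∈ C, |f x - s x| ≤ 3 * ε / 4 ∧ ε / 4 ≤ |s x| by
    obtain ⟨C, hC, -, K, s, h1, h2, h3, h4⟩ := h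
    exact ⟨K, s, h1, h2, h3, fun x => h4 x (hC trivial)⟩
  refine isCompact_univ.induction_on ?_ ?_ ?_ ?_
  · exact ⟨∅, subset_rfl, by simp, ∅, 0, isClosed_empty, by simp,
      fun x _ => continuousAt_const, by simp⟩
  · rintro A B hAB ⟨C, hC, h⟩
    exact ⟨C, hAB.trans hC, h⟩
  · rintro A B ⟨C, hC, hCf, K, s, hK, hKn, hs, hfs⟩ ⟨C', hC', hCf', K', s', hK', hKn', hs', hfs'⟩
    classical
    refine ⟨C ∪ C', Set.union_subset_union hC hC', fun μ hμ => ?_,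
      K ∪ K' ∪ frontier C, C.piecewise s s', (hK.union hK').union isClosed_frontier,
      fun μ hμ => ?_, fun x hx => ?_, fun x hx => ?_⟩
    · refine measure_mono_null (frontier_union_subset C C') (measure_union_null ?_ ?_)
      · exact measure_mono_null Set.inter_subset_left (hCf μ hμ)
      · exact measure_mono_null Set.inter_subset_right (hCf' μ hμ)
    · exact measure_union_null (measure_union_null (hKn μ hμ) (hKn' μ hμ)) (hCf μ hμ)
    · simp only [Set.mem_union, not_or] at hx
      obtain ⟨⟨hxK, hxK'⟩, hxC⟩ := hx
      by_cases hxc : x ∈ closure C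
      · have hxi : x ∈ interior C := by
          by_contra hni
          exact hxC ⟨hxc, hni⟩
        refine (hs x hxK).congr ?_
        filter_upwards [mem_interior_iff_mem_nhds.1 hxi] with y hy
        simp [hy]
      · refine (hs' x hxK').congr ?_
        filter_upwards [isClosed_closure.isOpen_compl.mem_nhds hxc] with y hy
        exact (Set.piecewise_eq_of_notMem _ _ _ fun h => hy (subset_closure h)).symm
    · by_cases hxC : x ∈ C
      · simpa [hxC] using hfs x hxC
      · simpa [hxC] using hfs' x (hx.resolve_left hxC)
  · intro x _
    obtain ⟨V, -, hxV, hVU, hVn⟩ := hS x {y | |f y - f x| < ε / 4}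
      (isOpen_lt (by fun_prop) continuous_const) (by simpa using hε)
    refine ⟨V, mem_nhdsWithin_of_mem_nhds (mem_interior_iff_mem_nhds.1 hxV), V, subset_rfl,
      fun μ hμ => (ProbabilityMeasure.null_iff_toMeasure_null μ _).1 (hVn μ hμ), ∅,
      fun _ => if ε / 4 ≤ |f x| then f x else ε / 4, isClosed_empty, by simp,
      fun y _ => continuousAt_const, fun y hy => ?_⟩
    have hy' : |f y - f x| < ε / 4 := hVU hy
    rw [abs_lt] at hy'
    split_ifs with hc
    · exact ⟨abs_le.2 ⟨by linarith, by linarith⟩, hc⟩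
    · rw [not_le, abs_lt] at hc
      exact ⟨abs_le.2 ⟨by linarith, by linarith⟩, le_abs_self _⟩

variable [BorelSpace X]

lemma ContinuousMap.integrable_of_probabilityMeasure (μ : ProbabilityMeasure X) (f : C(X, ℝ)) :
    Integrable f (μ : Measure X) :=
  f.continuous.integrable_of_hasCompactSupport (HasCompactSupport.of_compactSpace f)

lemma integral_sq_le_of_abs_le (μ : ProbabilityMeasure X) (u φ : C(X, ℝ)) {C : ℝ}
    (h0 : ∀ x, 0 ≤ φ x) (h1 : ∀ x, φ x ≤ 1) (h : ∀ x, |u x| ≤ C * φ x) :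
    ∫ x, (u x) ^ 2 ∂(μ : Measure X) ≤ C ^ 2 * ∫ x, φ x ∂(μ : Measure X) := by
  rw [← integral_const_mul]
  refine integral_mono (ContinuousMap.integrable_of_probabilityMeasure μ (u ^ 2))
    ((ContinuousMap.integrable_of_probabilityMeasure μ φ).const_mul _) fun x => ?_
  have h2 : (u x) ^ 2 ≤ (C * φ x) ^ 2 := by
    rw [← sq_abs]; exact pow_le_pow_left₀ (abs_nonneg _) (h x) 2
  have h3 : C ^ 2 * (φ x * φ x) ≤ C ^ 2 * φ x :=
    mul_le_mul_of_nonneg_left (by nlinarith [h0 x, h1 x]) (sq_nonneg C)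
  change (u x) ^ 2 ≤ C ^ 2 * φ x
  nlinarith

lemma integral_sq_le_norm_sq (μ : ProbabilityMeasure X) (u : C(X, ℝ)) :
    ∫ x, (u x) ^ 2 ∂(μ : Measure X) ≤ ‖u‖ ^ 2 := by
  simpa using integral_sq_le_of_abs_le μ u 1 (C := ‖u‖) (by simp) (by simp)
    (fun x => by simpa using u.norm_coe_le_norm x)

/-- Chebyshev's inequality. -/
lemma sq_mul_measureReal_le_integral_sq (μ : ProbabilityMeasure X) (u : C(X, ℝ)) {c : ℝ}
    (hc : 0 ≤ c) : c ^ 2 * (μ : Measure X).real {x | c ≤ |u x|} ≤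
      ∫ x, (u x) ^ 2 ∂(μ : Measure X) := by
  have h := mul_meas_ge_le_integral_of_nonneg (μ := (μ : Measure X)) (f := fun x => (u x) ^ 2)
    (ae_of_all _ fun x => sq_nonneg _)
    (ContinuousMap.integrable_of_probabilityMeasure μ (u ^ 2)) (c ^ 2)
  have hset : {x | c ^ 2 ≤ (u x) ^ 2} = {x | c ≤ |u x|} := by
    ext x; simp [sq_le_sq, abs_of_nonneg hc]
  rwa [hset] at h

lemma isTraceNormCauchy_of_abs_sub_le {φ : ℕ → C(X, ℝ)} {u : ℕ → C(X, ℝ)} {C : ℝ}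
    (h0 : ∀ n x, 0 ≤ φ n x) (h1 : ∀ n x, φ n x ≤ 1)
    (hφ : ∀ η > 0, ∃ N, ∀ n ≥ N, ∀ μ ∈ Δ, ∫ x, φ n x ∂(μ : Measure X) < η)
    (hu : ∀ N, ∀ n ≥ N, ∀ m ≥ N, ∀ x, |u n x - u m x| ≤ C * φ N x) :
    IsTraceNormCauchy Δ u := by
  intro η hη
  obtain ⟨N, hN⟩ := hφ ((η / 2) ^ 2 / (C ^ 2 + 1)) (by positivity)
  refine ⟨N, fun n hn m hm => lt_of_le_of_lt ?_ (half_lt_self hη)⟩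
  refine biSup_le_of_forall_mem_le (by positivity) fun μ hμ => ?_
  refine Real.sqrt_le_iff.2 ⟨by positivity, ?_⟩
  have h := integral_sq_le_of_abs_le μ (u n - u m) (φ N) (h0 N) (h1 N) (hu N n hn m hm)
  have hlt := (lt_div_iff₀ (by positivity)).1 (hN N le_rfl μ hμ)
  have hnn : 0 ≤ ∫ x, φ N x ∂(μ : Measure X) := integral_nonneg (h0 N)
  nlinarith

/-- The property that every continuous function is `‖·‖_{2,Δ}`-approximated by functions which
are invertible up to `‖·‖_{2,Δ}`-small error, with a uniform bound on the inverses. -/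
def HasApproxInvertible (Δ : Set (ProbabilityMeasure X)) : Prop :=
  ∀ (f : C(X, ℝ)) (ε : ℝ), 0 < ε → ∃ M : ℝ, ∀ η > 0, ∃ g h : C(X, ℝ), ‖h‖ ≤ M ∧
    ∀ μ ∈ Δ, ∫ x, (f x - g x) ^ 2 ∂(μ : Measure X) ≤ ε ∧
      ∫ x, (g x * h x - 1) ^ 2 ∂(μ : Measure X) ≤ η

lemma HasApproxInvertible.dense_smallNearZero (hinv : HasApproxInvertible Δ) {η : ℝ}
    (hη : 0 < η) : Dense (smallNearZero Δ η) := by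
  refine Metric.dense_iff.2 fun f r hr => ?_
  obtain ⟨M, hM⟩ := hinv f ((r / 2) ^ 2 * (η / 2)) (by positivity)
  obtain ⟨g, h, hh, hgh⟩ := hM ((1 / 2) ^ 2 * (η / 2)) (by positivity)
  let G : C(X, ℝ) := ⟨fun x => max (f x - r / 2) (min (f x + r / 2) (g x)), by fun_prop⟩
  have hG : ∀ x, G x = max (f x - r / 2) (min (f x + r / 2) (g x)) := fun x => rfl
  refine ⟨G, ?_, 1 / (2 * (|M| + 1)), by positivity, fun μ hμ => ?_⟩
  · refine Metric.mem_ball.2 (lt_of_le_of_lt ((ContinuousMap.dist_le (by positivity)).2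
      fun x => ?_) (half_lt_self hr))
    rw [Real.dist_eq, hG, abs_le]
    constructor
    · linarith [le_max_left (f x - r / 2) (min (f x + r / 2) (g x))]
    · have := max_le (a := f x - r / 2) (b := min (f x + r / 2) (g x)) (c := f x + r / 2)
        (by linarith) (min_le_left _ _)
      linarith
  · have hsub : {x | |G x| ≤ 1 / (2 * (|M| + 1))} ⊆
        {x | r / 2 ≤ |(f - g) x|} ∪ {x | 1 / 2 ≤ |(g * h - 1) x|} := by
      intro x hx
      by_contra hcon
      simp only [Set.mem_union, Set.mem_ofPred_eq, not_or, not_le] at hcon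
      obtain ⟨h1, h2⟩ := hcon
      rw [ContinuousMap.sub_apply, abs_lt] at h1
      have hGx : G x = g x := by
        rw [hG, min_eq_right (by linarith), max_eq_right (by linarith)]
      have hx' : |g x| ≤ 1 / (2 * (|M| + 1)) := hGx ▸ hx
      have hhx : |h x| ≤ |M| + 1 :=
        (h.norm_coe_le_norm x).trans (by linarith [le_abs_self M])
      have hprod : |g x * h x| ≤ 1 / 2 := by
        rw [abs_mul]
        refine (mul_le_mul hx' hhx (abs_nonneg _) (by positivity)).trans_eq ?_
        have : |M| + 1 ≠ 0 := by positivity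
        field_simp
      rw [ContinuousMap.sub_apply, ContinuousMap.mul_apply, ContinuousMap.one_apply,
        abs_lt] at h2
      linarith [(abs_le.1 hprod).2]
    have hA := (sq_mul_measureReal_le_integral_sq μ (f - g) (half_pos hr).le).trans (hgh μ hμ).1
    have hB := (sq_mul_measureReal_le_integral_sq μ (g * h - 1)
      (by norm_num : (0 : ℝ) ≤ 1 / 2)).trans (hgh μ hμ).2
    have hA' := le_of_mul_le_mul_left hA (by positivity)
    have hB' := le_of_mul_le_mul_left hB (by positivity)
    calc (μ : Measure X).real {x | |G x| ≤ 1 / (2 * (|M| + 1))}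
        ≤ _ := measureReal_mono hsub
      _ ≤ _ := measureReal_union_le _ _
      _ ≤ η := by linarith

end ContinuousFunctions

section SmallBoundary

variable {X : Type*} [TopologicalSpace X] [CompactSpace X] [TopologicalSpace.MetrizableSpace X]
  [MeasurableSpace X] [BorelSpace X] {Δ : Set (ProbabilityMeasure X)}

/-- A closed set that is null for every measure in a closed set `Δ` is uniformly null: it has
cutoff functions whose integrals tend to zero uniformly over `Δ`. -/
lemma exists_antitone_cutoff (hΔ : IsClosed Δ) {K : Set X} (hK : IsClosed K)
    (hnull : ∀ μ ∈ Δ, (μ : Measure X) K = 0) :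
    ∃ φ : ℕ → C(X, ℝ), (∀ n x, 0 ≤ φ n x) ∧ (∀ n x, φ n x ≤ 1) ∧ (∀ n, ∀ x ∈ K, φ n x = 1) ∧
      (∀ x, Antitone fun n => φ n x) ∧
      ∀ η > 0, ∃ N, ∀ n ≥ N, ∀ μ ∈ Δ, ∫ x, φ n x ∂(μ : Measure X) < η := by
  let _ := TopologicalSpace.metrizableSpaceMetric X
  have hpos : ∀ n : ℕ, (0 : ℝ) < 1 / (n + 1) := fun n => Nat.one_div_pos_of_nat
  let φ : ℕ → C(X, ℝ) := fun n =>
    ⟨fun x => (thickenedIndicator (hpos n) K x : ℝ), by fun_prop⟩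
  have hφ : ∀ n x, φ n x = (thickenedIndicator (hpos n) K x : ℝ) := fun n x => rfl
  have h0 : ∀ n x, 0 ≤ φ n x := fun n x => NNReal.coe_nonneg _
  have h1 : ∀ n x, φ n x ≤ 1 := fun n x => by
    rw [hφ]
    exact_mod_cast thickenedIndicator_le_one (hpos n) K x
  have hanti : ∀ x, Antitone fun n => φ n x := fun x n m hnm => by
    simp only [hφ]
    exact_mod_cast thickenedIndicator_mono (hpos m) (hpos n)
      (Nat.one_div_le_one_div hnm) K x
  refine ⟨φ, h0, h1, fun n x hx => ?_, hanti, fun η hη => ?_⟩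
  · rw [hφ]
    exact_mod_cast thickenedIndicator_one (hpos n) K hx
  have hlim : ∀ x ∉ K, Tendsto (fun n => φ n x) atTop (𝓝 0) := fun x hx => by
    have h := tendsto_pi_nhds.1 (thickenedIndicator_tendsto_indicator_closure hpos
      tendsto_one_div_add_atTop_nhds_zero_nat K) x
    rw [hK.closure_eq, Set.indicator_of_notMem hx] at h
    simpa only [hφ, NNReal.coe_zero] using NNReal.tendsto_coe.2 h
  have hunif : TendstoUniformlyOn (fun n (μ : ProbabilityMeasure X) =>
      ∫ x, φ n x ∂(μ : Measure X)) (fun _ => 0) atTop Δ := by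
    refine Antitone.tendstoUniformlyOn_of_forall_tendsto hΔ.isCompact
      (fun n => (ProbabilityMeasure.continuous_integral_continuousMap (φ n)).continuousOn)
      (fun μ _ n m hnm => integral_mono (ContinuousMap.integrable_of_probabilityMeasure μ _)
        (ContinuousMap.integrable_of_probabilityMeasure μ _) fun x => hanti x hnm)
      continuousOn_const fun μ hμ => ?_
    have h := tendsto_integral_of_dominated_convergence (μ := (μ : Measure X))
      (F := fun n x => φ n x) (f := fun _ => 0) (fun _ => 1)
      (fun n => (φ n).continuous.aestronglyMeasurable) (integrable_const _)
      (fun n => ae_of_all _ fun x => by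
        rw [Real.norm_of_nonneg (h0 n x)]; exact h1 n x)
      ((measure_eq_zero_iff_ae_notMem.1 (hnull μ hμ)).mono hlim)
    simpa using h
  obtain ⟨N, hN⟩ := eventually_atTop.1 (Metric.tendstoUniformlyOn_iff.1 hunif η hη)
  refine ⟨N, fun n hn μ hμ => ?_⟩
  have h := hN n hn μ hμ
  rw [Real.dist_eq, zero_sub, abs_neg] at h
  exact (le_abs_self _).trans_lt h

/-- Under the small boundary property, every continuous function is uniformly approximated by
sequences which are invertible in the `‖·‖_{2,Δ}`-completion. -/
lemma SmallBoundaryProperty.exists_approx_invertible (hΔ : IsClosed Δ)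
    (hS : SmallBoundaryProperty Δ) (f : C(X, ℝ)) {ε : ℝ} (hε : 0 < ε) :
    ∃ g h : ℕ → C(X, ℝ),
      (∃ M : ℝ, ∀ n, ‖g n‖ ≤ M) ∧ (∃ M : ℝ, ∀ n, ‖h n‖ ≤ M) ∧
      IsTraceNormCauchy Δ g ∧ IsTraceNormCauchy Δ h ∧
      (∀ n, ‖f - g n‖ < ε) ∧
      Tendsto
        (fun n => ⨆ μ ∈ Δ, ∫ x, (g n x * h n x - 1) ^ 2 ∂(μ : Measure X))
        atTop (nhds 0) := by
  obtain ⟨K, s, hK, hKn, hs, hfs⟩ := hS.exists_approx_away_from_zero f hε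
  obtain ⟨φ, h0, h1, hφK, hanti, hφ⟩ := exists_antitone_cutoff hΔ hK hKn
  have hs0 : ∀ x, s x ≠ 0 := fun x => abs_pos.1 (lt_of_lt_of_le (by positivity) (hfs x).2)
  have hsinv : ∀ x, |(s x)⁻¹| ≤ 4 / ε := fun x => by
    rw [abs_inv, ← inv_div]
    exact inv_anti₀ (by positivity) (hfs x).2
  have hfs' : ∀ x, |s x - f x| ≤ 3 * ε / 4 := fun x => abs_sub_comm (f x) (s x) ▸ (hfs x).1
  have hcut : ∀ n, Continuous fun x => 1 - φ n x := fun n => by fun_prop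
  have hcut0 : ∀ n, ∀ x ∈ K, 1 - φ n x = 0 := fun n x hx => by rw [hφK n x hx, sub_self]
  let g : ℕ → C(X, ℝ) := fun n => f + ⟨fun x => (1 - φ n x) * (s x - f x),
    continuous_mul_of_continuousAt_of_eq_zero (hcut n) (hcut0 n) hfs'
      fun x hx => (hs x hx).sub f.continuous.continuousAt⟩
  let h : ℕ → C(X, ℝ) := fun n => ⟨fun x => (1 - φ n x) * (s x)⁻¹,
    continuous_mul_of_continuousAt_of_eq_zero (hcut n) (hcut0 n) hsinv
      fun x hx => (hs x hx).inv₀ (hs0 x)⟩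
  have hg : ∀ n x, g n x = f x + (1 - φ n x) * (s x - f x) := fun n x => rfl
  have hh : ∀ n x, h n x = (1 - φ n x) * (s x)⁻¹ := fun n x => rfl
  have hφsub : ∀ N, ∀ n ≥ N, ∀ m ≥ N, ∀ x, |φ m x - φ n x| ≤ φ N x := fun N n hn m hm x => by
    have hn' : φ n x ≤ φ N x := hanti x hn
    have hm' : φ m x ≤ φ N x := hanti x hm
    exact abs_le.2 ⟨by linarith [h0 m x], by linarith [h0 n x]⟩
  have hfg : ∀ n, ‖f - g n‖ < ε := fun n => by
    refine lt_of_le_of_lt ((ContinuousMap.norm_le _ (C := 3 * ε / 4) (by positivity)).2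
      fun x => ?_) (by linarith)
    rw [ContinuousMap.sub_apply, hg, sub_add_cancel_left, norm_neg, norm_mul, Real.norm_eq_abs,
      Real.norm_eq_abs, abs_of_nonneg (sub_nonneg.2 (h1 n x))]
    exact (mul_le_of_le_one_left (abs_nonneg _) (by linarith [h0 n x])).trans (hfs' x)
  refine ⟨g, h, ⟨‖f‖ + ε, fun n => ?_⟩, ⟨4 / ε, fun n => ?_⟩, ?_, ?_, hfg, ?_⟩
  · have := norm_le_norm_add_norm_sub' (g n) f
    rw [norm_sub_rev] at this
    linarith [hfg n]
  · refine (ContinuousMap.norm_le _ (by positivity)).2 fun x => ?_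
    rw [hh, norm_mul, Real.norm_eq_abs, Real.norm_eq_abs,
      abs_of_nonneg (sub_nonneg.2 (h1 n x))]
    exact (mul_le_of_le_one_left (abs_nonneg _) (by linarith [h0 n x])).trans (hsinv x)
  · refine isTraceNormCauchy_of_abs_sub_le (C := 3 * ε / 4) h0 h1 hφ fun N n hn m hm x => ?_
    rw [hg, hg, show f x + (1 - φ n x) * (s x - f x) - (f x + (1 - φ m x) * (s x - f x)) =
      (s x - f x) * (φ m x - φ n x) by ring, abs_mul]
    exact mul_le_mul (hfs' x) (hφsub N n hn m hm x) (abs_nonneg _) (by positivity)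
  · refine isTraceNormCauchy_of_abs_sub_le (C := 4 / ε) h0 h1 hφ fun N n hn m hm x => ?_
    rw [hh, hh, show (1 - φ n x) * (s x)⁻¹ - (1 - φ m x) * (s x)⁻¹ =
      (s x)⁻¹ * (φ m x - φ n x) by ring, abs_mul]
    exact mul_le_mul (hsinv x) (hφsub N n hn m hm x) (abs_nonneg _) (by positivity)
  · have hgh : ∀ n x, |(g n * h n - 1) x| ≤ (2 + ‖f‖ * (4 / ε)) * φ n x := fun n x => by
      have hid : (g n * h n - 1) x =
          (f x * (s x)⁻¹ * (1 - φ n x) - (2 - φ n x)) * φ n x := by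
        rw [ContinuousMap.sub_apply, ContinuousMap.mul_apply, ContinuousMap.one_apply, hg, hh]
        field_simp [hs0 x]
        ring
      rw [hid, abs_mul, abs_of_nonneg (h0 n x)]
      refine mul_le_mul_of_nonneg_right ?_ (h0 n x)
      have hfi : |f x * (s x)⁻¹ * (1 - φ n x)| ≤ ‖f‖ * (4 / ε) := by
        rw [abs_mul, abs_mul, abs_of_nonneg (sub_nonneg.2 (h1 n x))]
        refine (mul_le_of_le_one_right (by positivity) (by linarith [h0 n x])).trans ?_
        exact mul_le_mul (f.norm_coe_le_norm x) (hsinv x) (abs_nonneg _) (norm_nonneg _)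
      rw [abs_le] at hfi ⊢
      constructor <;> linarith [h0 n x, h1 n x, hfi.1, hfi.2]
    set C : ℝ := 2 + ‖f‖ * (4 / ε)
    refine Metric.tendsto_atTop.2 fun η hη => ?_
    obtain ⟨N, hN⟩ := hφ (η / 2 / (C ^ 2 + 1)) (by positivity)
    refine ⟨N, fun n hn => ?_⟩
    rw [Real.dist_eq, sub_zero,
      abs_of_nonneg (biSup_nonneg_of_nonneg fun μ => integral_nonneg fun x => sq_nonneg _)]
    refine lt_of_le_of_lt (biSup_le_of_forall_mem_le (by positivity) fun μ hμ => ?_)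
      (half_lt_self hη)
    have hle := integral_sq_le_of_abs_le μ (g n * h n - 1) (φ n) (h0 n) (h1 n) (hgh n)
    have hlt := (lt_div_iff₀ (by positivity)).1 (hN n hn μ hμ)
    have hnn : 0 ≤ ∫ x, φ n x ∂(μ : Measure X) := integral_nonneg (h0 n)
    simp only [ContinuousMap.sub_apply, ContinuousMap.mul_apply, ContinuousMap.one_apply] at hle
    nlinarith

/-- A Baire category argument: some perturbation of a Urysohn function has a `Δ`-null zero set. -/
lemma HasApproxInvertible.smallBoundaryProperty (hinv : HasApproxInvertible Δ) :
    SmallBoundaryProperty Δ := by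
  intro x U hU hxU
  have hdense : Dense (⋂ n : ℕ, smallNearZero Δ (1 / ((n : ℝ) + 1))) :=
    dense_iInter_of_isOpen_nat (fun n => isOpen_smallNearZero Δ _)
      fun n => hinv.dense_smallNearZero Nat.one_div_pos_of_nat
  obtain ⟨f, hf0, hf1, -⟩ := exists_continuous_zero_one_of_isClosed hU.isClosed_compl
    (isClosed_singleton (x := x)) (Set.disjoint_singleton_right.2 fun h => h hxU)
  obtain ⟨F, hFd, hF⟩ := hdense.exists_dist_lt
    (f - ContinuousMap.const X (1 / 2))
    (by norm_num : (0 : ℝ) < 1 / 4)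
  have hclose : ∀ y, |f y - 1 / 2 - F y| < 1 / 4 := fun y => by
    have h := (ContinuousMap.dist_apply_le_dist y).trans_lt hF
    rwa [Real.dist_eq] at h
  simp only [abs_lt] at hclose
  refine ⟨{y | 0 ≤ F y}, isClosed_le continuous_const F.continuous, ?_, fun y hy => ?_,
    fun μ hμ => ?_⟩
  · refine interior_mono (s := {y | 0 < F y}) (fun y (hy : 0 < F y) => hy.le) ?_
    rw [(isOpen_lt continuous_const F.continuous).interior_eq]
    have hfx : f x = 1 := hf1 rfl
    change 0 < F x
    linarith [(hclose x).2]
  · by_contra hyU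
    have hfy : f y = 0 := hf0 hyU
    have hy' : 0 ≤ F y := hy
    linarith [(hclose y).1]
  · rw [ProbabilityMeasure.null_iff_toMeasure_null]
    refine measure_mono_null (frontier_le_subset_eq continuous_const F.continuous) ?_
    rw [← measureReal_eq_zero_iff]
    refine le_antisymm (ge_of_tendsto' tendsto_one_div_add_atTop_nhds_zero_nat fun n => ?_)
      measureReal_nonneg
    obtain ⟨δ, hδ, hFδ⟩ := Set.mem_iInter.1 hFd n
    refine (measureReal_mono fun y hy => ?_).trans (hFδ μ hμ)
    have hy' : 0 = F y := hy
    simpa [← hy'] using hδ.le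

end SmallBoundary

theorem sbp_and_trace_norm_completion
    {X : Type*} [TopologicalSpace X] [CompactSpace X] [TopologicalSpace.MetrizableSpace X]
    [MeasurableSpace X] [BorelSpace X]
    (Δ : Set (ProbabilityMeasure X)) (hΔ : IsClosed Δ) :
    (SmallBoundaryProperty Δ →
      ∀ (f : C(X, ℝ)) (ε : ℝ), 0 < ε →
        ∃ g h : ℕ → C(X, ℝ),
          (∃ M : ℝ, ∀ n, ‖g n‖ ≤ M) ∧ (∃ M : ℝ, ∀ n, ‖h n‖ ≤ M) ∧
          IsTraceNormCauchy Δ g ∧ IsTraceNormCauchy Δ h ∧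
          (∀ n, ‖f - g n‖ < ε) ∧
          Tendsto
            (fun n => ⨆ μ ∈ Δ, ∫ x, (g n x * h n x - 1) ^ 2 ∂(μ : Measure X))
            atTop (nhds 0)) ∧
    ((∀ (f : C(X, ℝ)) (ε : ℝ), 0 < ε →
        ∃ g h : ℕ → C(X, ℝ),
          (∃ M : ℝ, ∀ n, ‖g n‖ ≤ M) ∧ (∃ M : ℝ, ∀ n, ‖h n‖ ≤ M) ∧
          IsTraceNormCauchy Δ g ∧ IsTraceNormCauchy Δ h ∧
          (Filter.limsup
              (fun n => ⨆ μ ∈ Δ,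
                Real.sqrt (∫ x, (f x - g n x) ^ 2 ∂(μ : Measure X)))
              atTop < ε) ∧
          Tendsto
            (fun n => ⨆ μ ∈ Δ, ∫ x, (g n x * h n x - 1) ^ 2 ∂(μ : Measure X))
            atTop (nhds 0)) →
      SmallBoundaryProperty Δ) := by
  refine ⟨fun hS f ε hε => hS.exists_approx_invertible hΔ f hε, fun H => ?_⟩
  refine HasApproxInvertible.smallBoundaryProperty fun f ε hε => ?_
  obtain ⟨g, h, ⟨Mg, hMg⟩, ⟨Mh, hMh⟩, -, -, hlim, hinv⟩ := H f (√ε) (Real.sqrt_pos.2 hε)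
  have hMg0 : 0 ≤ Mg := (norm_nonneg _).trans (hMg 0)
  have hMh0 : 0 ≤ Mh := (norm_nonneg _).trans (hMh 0)
  have hbd1 : ∀ n, ∀ μ ∈ Δ, √(∫ x, (f x - g n x) ^ 2 ∂(μ : Measure X)) ≤ ‖f‖ + Mg :=
    fun n μ _ => Real.sqrt_le_iff.2 ⟨by positivity,
      (integral_sq_le_norm_sq μ (f - g n)).trans (pow_le_pow_left₀ (norm_nonneg _)
        ((norm_sub_le _ _).trans (by gcongr; exact hMg n)) 2)⟩
  have hbd2 : ∀ n, ∀ μ ∈ Δ, ∫ x, (g n x * h n x - 1) ^ 2 ∂(μ : Measure X) ≤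
      ‖g n * h n - 1‖ ^ 2 := fun n μ _ => integral_sq_le_norm_sq μ (g n * h n - 1)
  have hev := eventually_lt_of_limsup_lt hlim
    (isBoundedUnder_of ⟨‖f‖ + Mg, fun n => biSup_le_of_forall_mem_le (by positivity) (hbd1 n)⟩)
  refine ⟨Mh, fun η hη => ?_⟩
  obtain ⟨n, hn1, hn2⟩ := (hev.and (hinv.eventually_lt_const hη)).exists
  refine ⟨g n, h n, hMh n, fun μ hμ => ⟨?_, ?_⟩⟩
  · exact (Real.sqrt_le_sqrt_iff hε.le).1
      ((le_biSup_of_forall_mem_le (by positivity) (hbd1 n) hμ).trans hn1.le)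
  · exact (le_biSup_of_forall_mem_le (by positivity) (hbd2 n) hμ).trans hn2.le
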